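/- arXiv:1806.06111 — 4 statements merged into one kernel-verified Lean document; each statement's English description precedes it below -/
import Mathlib

section
/- Let K, J be positive integers, let η₁, …, η_K ∈ ℝ^J, c₁, …, c_K ∈ ℝ, and r > 0, and assume the affine set A = {x ∈ ℝ^J : ⟨η_k, x⟩ = c_k for all k} is nonempty. Then the system {⟨η_k, θ⟩ = c_k for all k = 1,…,K, and ‖θ‖² = r} has exactly one solution θ ∈ ℝ^J if and only if there exists a solution θ of this system that is the minimum-norm point of A, i.e. ‖θ‖ ≤ ‖x‖ for every x ∈ A. -/
open scoped RealInnerProductSpace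

/-- If `θ` is the only vector of its norm on the line `θ + ℝ v`, then it is orthogonal to `v`. -/
theorem inner_eq_zero_of_unique_norm_on_line {E : Type*} [NormedAddCommGroup E]
    [InnerProductSpace ℝ E] {θ v : E} (h : ∀ t : ℝ, ‖θ + t • v‖ ^ 2 = ‖θ‖ ^ 2 → θ + t • v = θ) :
    ⟪θ, v⟫ = 0 := by
  by_cases hv : v = 0
  · simp [hv]
  have hn : ‖v‖ ^ 2 ≠ 0 := by simpa using hv
  have key := h (-2 * ⟪θ, v⟫ / ‖v‖ ^ 2) (by
    rw [norm_add_sq_real, norm_smul, inner_smul_right, mul_pow, Real.norm_eq_abs, sq_abs]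
    field_simp
    ring)
  simpa [hv] using key

/-- Two vectors of equal norm whose midpoint is at least as long coincide. -/
theorem eq_of_norm_eq_of_norm_le_midpoint {E : Type*} [NormedAddCommGroup E]
    [InnerProductSpace ℝ E] {x y : E} (hxy : ‖x‖ ^ 2 = ‖y‖ ^ 2)
    (h : ‖x‖ ≤ ‖(2⁻¹ : ℝ) • (x + y)‖) : x = y := by
  have hp := parallelogram_law_with_norm ℝ x y
  rw [norm_smul, Real.norm_of_nonneg (by norm_num)] at h
  have h0 : ‖x - y‖ ^ 2 = 0 := by
    nlinarith [norm_nonneg x, norm_nonneg (x + y), sq_nonneg ‖x - y‖]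
  simpa [sub_eq_zero] using h0

/-- Lemma 2 of the paper.  For `η₁, …, η_K ∈ ℝ^J`, `c₁, …, c_K ∈ ℝ` and
`r > 0`, with the affine set `A = {x | ∀ k, ⟨η_k, x⟩ = c_k}` nonempty, the system
`(∀ k, ⟨η_k, θ⟩ = c_k) ∧ ‖θ‖² = r` has exactly one solution iff some solution of it is the
minimum-norm point of `A`. -/
theorem stmt1 (K J : ℕ) (hK : 0 < K) (hJ : 0 < J)
    (η : Fin K → EuclideanSpace ℝ (Fin J)) (c : Fin K → ℝ) (r : ℝ) (hr : 0 < r)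
    (hA : ({x : EuclideanSpace ℝ (Fin J) | ∀ k, ⟪η k, x⟫ = c k}).Nonempty) :
    (∃! θ : EuclideanSpace ℝ (Fin J), (∀ k, ⟪η k, θ⟫ = c k) ∧ ‖θ‖ ^ 2 = r) ↔
      (∃ θ : EuclideanSpace ℝ (Fin J), ((∀ k, ⟪η k, θ⟫ = c k) ∧ ‖θ‖ ^ 2 = r) ∧
        ∀ x ∈ {x : EuclideanSpace ℝ (Fin J) | ∀ k, ⟪η k, x⟫ = c k}, ‖θ‖ ≤ ‖x‖) := by
  constructor
  · rintro ⟨θ, ⟨hθ, hr'⟩, huniq⟩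
    refine ⟨θ, ⟨hθ, hr'⟩, fun x hx => ?_⟩
    have horth : ⟪θ, x - θ⟫ = 0 := inner_eq_zero_of_unique_norm_on_line fun t ht =>
      huniq _ ⟨fun k => by
        rw [inner_add_right, inner_smul_right, inner_sub_right, hx k, hθ k]; ring, ht.trans hr'⟩
    have hsq := norm_add_sq_real θ (x - θ)
    rw [add_sub_cancel, horth] at hsq
    exact pow_le_pow_iff_left₀ (norm_nonneg θ) (norm_nonneg x) two_ne_zero |>.mp
      (by nlinarith [sq_nonneg ‖x - θ‖])
  · rintro ⟨θ, ⟨hθ, hr'⟩, hmin⟩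
    refine ⟨θ, ⟨hθ, hr'⟩, fun y hy => ?_⟩
    refine (eq_of_norm_eq_of_norm_le_midpoint (hr'.trans hy.2.symm) (hmin _ fun k => ?_)).symm
    rw [inner_smul_right, inner_add_right, hθ k, hy.1 k]
    ring
end

section
/- Let p be a positive integer and let Y be a positive definite Hermitian p×p complex matrix. Then for every positive definite Hermitian p×p matrix X, tr(X · log Y − X · log X + X) ≤ tr Y, with equality when X = Y; consequently tr Y = sup over positive definite Hermitian X of tr(X · log Y − X · log X + X). (For Hermitian positive semidefinite matrices A, B the trace tr(AB) is real, so all traces appearing are real numbers.) -/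
open scoped ComplexOrder

/-- The matrix logarithm of a (positive definite Hermitian) matrix, via the continuous
functional calculus for Hermitian matrices. -/
noncomputable def matLog {p : ℕ} (A : Matrix (Fin p) (Fin p) ℂ) : Matrix (Fin p) (Fin p) ℂ :=
  cfc Real.log A

theorem trace_diagonal_mul_mul_diagonal_mul_conjTranspose {n : Type*} [Fintype n] [DecidableEq n]
    (d e : n → ℝ) (W : Matrix n n ℂ) :
    (Matrix.diagonal (fun i => (d i : ℂ)) * W * Matrix.diagonal (fun j => (e j : ℂ)) *
      W.conjTranspose).trace.re = ∑ i, ∑ j, d i * e j * Complex.normSq (W i j) := by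
  simp only [Matrix.trace, Matrix.diag, Complex.re_sum, Matrix.mul_apply (N := W.conjTranspose),
    Matrix.mul_diagonal, Matrix.diagonal_mul, Matrix.conjTranspose_apply]
  refine Finset.sum_congr rfl fun i _ => Finset.sum_congr rfl fun j _ => ?_
  simp only [Complex.star_def]
  rw [show (d i : ℂ) * W i j * e j * (starRingEnd ℂ) (W i j)
      = d i * e j * (W i j * (starRingEnd ℂ) (W i j)) by ring, Complex.mul_conj]
  norm_cast

/-- The trace of a product of functions of two Hermitian matrices is a sum over pairs of
eigenvalues, weighted by the squared overlaps of the eigenvectors. -/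
theorem re_trace_cfc_mul_cfc {n : Type*} [Fintype n] [DecidableEq n] {A B : Matrix n n ℂ}
    (hA : A.IsHermitian) (hB : B.IsHermitian) (f g : ℝ → ℝ) :
    (cfc f A * cfc g B).trace.re = ∑ i, ∑ j, f (hA.eigenvalues i) * g (hB.eigenvalues j) *
      Complex.normSq ((star (hA.eigenvectorUnitary : Matrix n n ℂ) *
        (hB.eigenvectorUnitary : Matrix n n ℂ)) i j) := by
  rw [← trace_diagonal_mul_mul_diagonal_mul_conjTranspose (fun i => f (hA.eigenvalues i))
    (fun j => g (hB.eigenvalues j)), hA.cfc_eq, hB.cfc_eq, Matrix.IsHermitian.cfc,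
    Matrix.IsHermitian.cfc, Unitary.conjStarAlgAut_apply, Unitary.conjStarAlgAut_apply,
    Matrix.mul_assoc, Matrix.mul_assoc, Matrix.trace_mul_comm, Matrix.conjTranspose_mul]
  simp only [Matrix.star_eq_conjTranspose, Matrix.conjTranspose_conjTranspose, Matrix.mul_assoc]
  rfl

/-- Nonnegativity of the Bregman divergence of `x ↦ x * log x` on the positive reals. -/
theorem mul_log_sub_mul_log_add_le {a b : ℝ} (ha : 0 < a) (hb : 0 < b) :
    a * Real.log b - a * Real.log a + a ≤ b := by
  have h := mul_le_mul_of_nonneg_left (Real.log_le_sub_one_of_pos (div_pos hb ha)) ha.le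
  rw [Real.log_div hb.ne' ha.ne', mul_sub, mul_sub, mul_div_cancel₀ _ ha.ne'] at h
  linarith

theorem re_trace_mul_matLog_sub_le {p : ℕ} {X Y : Matrix (Fin p) (Fin p) ℂ}
    (hX : X.PosDef) (hY : Y.PosDef) :
    (Matrix.trace (X * matLog Y - X * matLog X + X)).re ≤ (Matrix.trace Y).re := by
  have hX_id : cfc (fun x : ℝ => x) X = X := cfc_id' ℝ X hX.1
  have hY_id : cfc (fun x : ℝ => x) Y = Y := cfc_id' ℝ Y hY.1
  have hX_one : cfc (fun _ : ℝ => (1 : ℝ)) X = 1 := cfc_const_one ℝ X hX.1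
  have hY_one : cfc (fun _ : ℝ => (1 : ℝ)) Y = 1 := cfc_const_one ℝ Y hY.1
  have hX_log : cfc (fun x : ℝ => x * Real.log x) X = X * matLog X := by
    rw [cfc_mul (fun x : ℝ => x) Real.log X continuousOn_id
      (X.finite_real_spectrum.continuousOn _), hX_id, matLog]
  have h_log := re_trace_cfc_mul_cfc hX.1 hY.1 (fun x => x) Real.log
  have h_ent := re_trace_cfc_mul_cfc hX.1 hY.1 (fun x => x * Real.log x) (fun _ => 1)
  have h_left := re_trace_cfc_mul_cfc hX.1 hY.1 (fun x => x) (fun _ => 1)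
  have h_right := re_trace_cfc_mul_cfc hX.1 hY.1 (fun _ => 1) (fun x => x)
  rw [hX_id, ← matLog] at h_log
  rw [hX_log, hY_one, mul_one] at h_ent
  rw [hX_id, hY_one, mul_one] at h_left
  rw [hX_one, hY_id, one_mul] at h_right
  rw [Matrix.trace_add, Matrix.trace_sub, Complex.add_re, Complex.sub_re, h_log, h_ent, h_left,
    h_right]
  simp only [← Finset.sum_sub_distrib, ← Finset.sum_add_distrib, ← sub_mul, ← add_mul, mul_one,
    one_mul]
  exact Finset.sum_le_sum fun i _ => Finset.sum_le_sum fun j _ =>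
    mul_le_mul_of_nonneg_right
      (mul_log_sub_mul_log_add_le (hX.eigenvalues_pos i) (hY.eigenvalues_pos j))
      (Complex.normSq_nonneg _)


/-- variational formula for the trace.  For positive definite Hermitian `Y`:
`tr(X log Y - X log X + X) ≤ tr Y` for every positive definite Hermitian `X`, with equality at
`X = Y`; hence `tr Y` is the supremum (a greatest element) of these quantities. -/
theorem stmt8 (p : ℕ) (hp : 0 < p) (Y : Matrix (Fin p) (Fin p) ℂ) (hY : Y.PosDef) :
    (∀ X : Matrix (Fin p) (Fin p) ℂ, X.PosDef →
      (Matrix.trace (X * matLog Y - X * matLog X + X)).re ≤ (Matrix.trace Y).re) ∧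
    (Matrix.trace (Y * matLog Y - Y * matLog Y + Y)).re = (Matrix.trace Y).re ∧
    IsGreatest {t : ℝ | ∃ X : Matrix (Fin p) (Fin p) ℂ, X.PosDef ∧
        t = (Matrix.trace (X * matLog Y - X * matLog X + X)).re}
      (Matrix.trace Y).re := by
  refine ⟨fun X hX => re_trace_mul_matLog_sub_le hX hY, by rw [sub_self, zero_add],
    ⟨Y, hY, by rw [sub_self, zero_add]⟩, ?_⟩
  rintro t ⟨X, hX, rfl⟩
  exact re_trace_mul_matLog_sub_le hX hY
end

section
/- Let p be a positive integer, n > 0 a real number, and let x be a random vector in ℝ^p such that E exp(⟨γ, x⟩) ≤ exp(‖γ‖²/(2n)) for every γ ∈ ℝ^p. Then for every θ with 0 ≤ θ < n/2, E exp(θ‖x‖²) ≤ (1 − 2θ/n)^{−p/2}. -/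
open MeasureTheory
open scoped RealInnerProductSpace ENNReal

section Gaussian

variable {V : Type*} [NormedAddCommGroup V] [InnerProductSpace ℝ V] [FiniteDimensional ℝ V]
  [MeasurableSpace V] [BorelSpace V]

/-- The Laplace transform of the Gaussian density `exp (-b ‖v‖²)`, up to normalization. -/
theorem lintegral_exp_neg_mul_sq_norm_add_inner {b : ℝ} (hb : 0 < b) (w : V) :
    ∫⁻ v : V, ENNReal.ofReal (Real.exp (-b * ‖v‖ ^ 2 + ⟪v, w⟫)) =
      ENNReal.ofReal ((Real.pi / b) ^ (Module.finrank ℝ V / 2 : ℝ) *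
        Real.exp (‖w‖ ^ 2 / (4 * b))) := by
  have hb' : 0 < (b : ℂ).re := by simpa using hb
  have hcast (v : V) : Complex.exp (-(b : ℂ) * (‖v‖ : ℂ) ^ 2 + 1 * (⟪w, v⟫ : ℝ)) =
      ((Real.exp (-b * ‖v‖ ^ 2 + ⟪v, w⟫) : ℝ) : ℂ) := by
    rw [real_inner_comm]
    push_cast
    rw [one_mul]
  have hint : Integrable (fun v : V ↦ Real.exp (-b * ‖v‖ ^ 2 + ⟪v, w⟫)) := by
    have h := GaussianFourier.integrable_cexp_neg_mul_sq_norm_add hb' 1 w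
    simp_rw [hcast] at h
    exact h.re
  have hval := GaussianFourier.integral_cexp_neg_mul_sq_norm_add hb' 1 w
  simp_rw [hcast] at hval
  rw [integral_complex_ofReal] at hval
  rw [← ofReal_integral_eq_lintegral_ofReal hint (ae_of_all _ fun v ↦ (Real.exp_pos _).le)]
  congr 1
  rw [← Complex.ofReal_inj, hval, Complex.ofReal_mul, Complex.ofReal_cpow (by positivity)]
  push_cast
  rw [one_pow, one_mul]

/-- If the Laplace transform of `x` is at most `exp (a ‖γ‖²)`, then integrating it against the
Gaussian density `exp (-b ‖γ‖²)`, `b > a`, bounds the exponential moment of `‖x‖²`. -/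
theorem lintegral_exp_sq_norm_le_of_laplace_le {Ω : Type*} [MeasurableSpace Ω] {μ : Measure Ω}
    [SFinite μ] {x : Ω → V} (hx : AEMeasurable x μ) {a b : ℝ} (hb : 0 < b) (hab : a < b)
    (h : ∀ γ : V, ∫⁻ ω, ENNReal.ofReal (Real.exp ⟪γ, x ω⟫) ∂μ ≤
      ENNReal.ofReal (Real.exp (a * ‖γ‖ ^ 2))) :
    ∫⁻ ω, ENNReal.ofReal (Real.exp (‖x ω‖ ^ 2 / (4 * b))) ∂μ ≤
      ENNReal.ofReal ((b / (b - a)) ^ (Module.finrank ℝ V / 2 : ℝ)) := by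
  have hsub : 0 < b - a := sub_pos.2 hab
  set C : ℝ := (Real.pi / b) ^ (Module.finrank ℝ V / 2 : ℝ) with hC
  have hCpos : 0 < C := by positivity
  have hmeas : AEMeasurable (Function.uncurry fun (ω : Ω) (γ : V) ↦
      ENNReal.ofReal (Real.exp (-b * ‖γ‖ ^ 2 + ⟪γ, x ω⟫))) (μ.prod volume) := by
    have hx' : AEMeasurable (fun z : Ω × V ↦ x z.1) (μ.prod volume) := hx.comp_fst
    have hγ : AEMeasurable (fun z : Ω × V ↦ z.2) (μ.prod volume) := measurable_snd.aemeasurable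
    exact (Real.measurable_exp.comp_aemeasurable
      (((hγ.norm.pow_const 2).const_mul (-b)).add (hγ.inner hx'))).ennreal_ofReal
  have key : ENNReal.ofReal C * ∫⁻ ω, ENNReal.ofReal (Real.exp (‖x ω‖ ^ 2 / (4 * b))) ∂μ ≤
      ENNReal.ofReal C * ENNReal.ofReal ((b / (b - a)) ^ (Module.finrank ℝ V / 2 : ℝ)) := by
    calc _ = ∫⁻ ω, (∫⁻ γ : V, ENNReal.ofReal (Real.exp (-b * ‖γ‖ ^ 2 + ⟪γ, x ω⟫))) ∂μ := by
          simp_rw [lintegral_exp_neg_mul_sq_norm_add_inner hb, ← hC, ENNReal.ofReal_mul hCpos.le]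
          rw [lintegral_const_mul' _ _ ENNReal.ofReal_ne_top]
      _ = ∫⁻ γ : V, ∫⁻ ω, ENNReal.ofReal (Real.exp (-b * ‖γ‖ ^ 2 + ⟪γ, x ω⟫)) ∂μ :=
          lintegral_lintegral_swap hmeas
      _ ≤ ∫⁻ γ : V, ENNReal.ofReal (Real.exp (-(b - a) * ‖γ‖ ^ 2 + ⟪γ, (0 : V)⟫)) := by
          refine lintegral_mono fun γ ↦ ?_
          simp_rw [Real.exp_add, ENNReal.ofReal_mul (Real.exp_pos _).le]
          rw [lintegral_const_mul' _ _ ENNReal.ofReal_ne_top]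
          refine (mul_le_mul_right (h γ) _).trans_eq ?_
          rw [← ENNReal.ofReal_mul (Real.exp_pos _).le, ← ENNReal.ofReal_mul (Real.exp_pos _).le,
            ← Real.exp_add, ← Real.exp_add, inner_zero_right]
          ring_nf
      _ = _ := by
          rw [lintegral_exp_neg_mul_sq_norm_add_inner hsub, ← ENNReal.ofReal_mul hCpos.le, hC,
            ← Real.mul_rpow (by positivity) (by positivity),
            div_mul_div_cancel₀ hb.ne']
          simp
  exact (ENNReal.mul_le_mul_iff_right (by simpa using hCpos) ENNReal.ofReal_ne_top).1 key

end Gaussian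

/-- exponential moment of the squared norm of a sub-Gaussian vector.
If `E exp(⟨γ, x⟩) ≤ exp(‖γ‖²/(2n))` for every `γ ∈ ℝ^p`, then for every `0 ≤ θ < n/2`:
`E exp(θ‖x‖²) ≤ (1 - 2θ/n)^{-p/2}`. -/
theorem stmt16 (p : ℕ) (hp : 0 < p) (n : ℝ) (hn : 0 < n)
    {Ω : Type*} [MeasurableSpace Ω] (μ : Measure Ω) [IsProbabilityMeasure μ]
    (x : Ω → EuclideanSpace ℝ (Fin p)) (hx : AEMeasurable x μ)
    (hsubG : ∀ γ : EuclideanSpace ℝ (Fin p),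
      (∫⁻ ω, ENNReal.ofReal (Real.exp ⟪γ, x ω⟫) ∂μ)
        ≤ ENNReal.ofReal (Real.exp (‖γ‖ ^ 2 / (2 * n)))) :
    ∀ θ : ℝ, 0 ≤ θ → θ < n / 2 →
      (∫⁻ ω, ENNReal.ofReal (Real.exp (θ * ‖x ω‖ ^ 2)) ∂μ)
        ≤ ENNReal.ofReal ((1 - 2 * θ / n) ^ (-(p : ℝ) / 2)) := by
  intro θ hθ hθn
  rcases hθ.eq_or_lt with rfl | hθ
  · simp
  have hden : 0 < 1 - 2 * θ / n := by
    rw [sub_pos, div_lt_one hn]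
    linarith
  have hab : 1 / (2 * n) < 1 / (4 * θ) :=
    one_div_lt_one_div_of_lt (by positivity) (by linarith)
  have h := lintegral_exp_sq_norm_le_of_laplace_le hx (by positivity) hab fun γ ↦ by
    simpa only [one_div_mul_eq_div] using hsubG γ
  have hexp (ω : Ω) : ‖x ω‖ ^ 2 / (4 * (1 / (4 * θ))) = θ * ‖x ω‖ ^ 2 := by
    field_simp
  have hratio : 1 / (4 * θ) / (1 / (4 * θ) - 1 / (2 * n)) = (1 - 2 * θ / n)⁻¹ := by
    have hsub : 1 / (4 * θ) - 1 / (2 * n) = 1 / (4 * θ) * (1 - 2 * θ / n) := by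
      field_simp
      ring
    rw [hsub, div_mul_cancel_left₀ (by positivity)]
  simp_rw [hexp] at h
  rwa [hratio, finrank_euclideanSpace_fin, Real.inv_rpow hden.le, ← Real.rpow_neg hden.le,
    ← neg_div] at h
end

section
/- Let X be a nonnegative random variable and p ≥ 1 a real number such that P(X > p + s) ≤ 2·exp(−s²/(6.6·p)) for every s > 0. Then E[X^{3/2}] ≤ 14·p^{3/2}. -/
open MeasureTheory

/-- The integral of `2 s exp(-s² / (6.6 p))` over the positive half-line is `6.6 p`. -/
lemma lintegral_Ioi_exp_neg_sq_mul {p : ℝ} (hp : 0 < p) :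
    ∫⁻ s in Set.Ioi (0 : ℝ),
        ENNReal.ofReal (2 * Real.exp (-s ^ 2 / (6.6 * p)) * s ^ ((2 : ℝ) - 1))
      = ENNReal.ofReal (6.6 * p) := by
  have hb : (0 : ℝ) < (6.6 * p)⁻¹ := by positivity
  have hform : ∀ s : ℝ, 2 * Real.exp (-s ^ 2 / (6.6 * p)) * s ^ ((2 : ℝ) - 1)
      = 2 * (s ^ (1 : ℝ) * Real.exp (-(6.6 * p)⁻¹ * s ^ (2 : ℝ))) := by
    intro s
    rw [show (2 : ℝ) - 1 = 1 by norm_num, Real.rpow_two, Real.rpow_one,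
      show -s ^ 2 / (6.6 * p) = -(6.6 * p)⁻¹ * s ^ 2 by rw [div_eq_mul_inv]; ring]
    ring
  simp_rw [hform]
  rw [← ofReal_integral_eq_lintegral_ofReal]
  · rw [integral_const_mul, integral_rpow_mul_exp_neg_mul_rpow (by norm_num) (by norm_num) hb]
    congr 1
    norm_num [Real.rpow_neg_one]
    ring
  · exact (integrableOn_rpow_mul_exp_neg_mul_rpow (by norm_num) (by norm_num) hb).const_mul 2
  · filter_upwards [ae_restrict_mem measurableSet_Ioi] with s hs
    have : (0 : ℝ) < s := hs
    simp only [Pi.zero_apply]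
    positivity

/-- A Gaussian-type upper tail above `p` bounds the second moment of the excess over `p`. -/
lemma lintegral_sq_excess_le {Ω : Type*} [MeasurableSpace Ω] (μ : Measure Ω)
    [IsFiniteMeasure μ] {X : Ω → ℝ} (hX : Measurable X) {p : ℝ} (hp : 0 < p)
    (hTail : ∀ s : ℝ, 0 < s →
      (μ {ω | p + s < X ω}).toReal ≤ 2 * Real.exp (-s ^ 2 / (6.6 * p))) :
    ∫⁻ ω, ENNReal.ofReal (max (X ω - p) 0 ^ (2 : ℝ)) ∂μ ≤ ENNReal.ofReal (13.2 * p) := by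
  rw [lintegral_rpow_eq_lintegral_meas_lt_mul μ (f := fun ω => max (X ω - p) 0)
    (Filter.Eventually.of_forall fun ω => le_max_right _ _) ((hX.sub_const p).max measurable_const).aemeasurable (by norm_num)]
  calc _ ≤ ENNReal.ofReal 2 * ENNReal.ofReal (6.6 * p) := by
        rw [← lintegral_Ioi_exp_neg_sq_mul hp]
        refine mul_le_mul' le_rfl
          (setLIntegral_mono' measurableSet_Ioi fun s (hs : (0 : ℝ) < s) => ?_)
        rw [ENNReal.ofReal_mul (by positivity)]
        gcongr
        rw [ENNReal.le_ofReal_iff_toReal_le (measure_ne_top _ _) (by positivity)]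
        convert hTail s hs using 5 with ω
        rw [lt_max_iff, or_iff_left hs.not_gt, lt_sub_iff_add_lt, add_comm]
    _ = _ := by
        rw [← ENNReal.ofReal_mul (by norm_num)]
        congr 1
        ring

/-- A bound for `x ^ (3 / 2)` that is quadratic in the excess of `x` over `p`. -/
lemma rpow_three_halves_le {x p : ℝ} (hx : 0 ≤ x) (hp : 0 < p) :
    x ^ ((3 : ℝ) / 2)
      ≤ 7 * p ^ ((3 : ℝ) / 2) + p ^ ((3 : ℝ) / 2) / (2 * p ^ 2) * max (x - p) 0 ^ (2 : ℝ) := by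
  obtain ⟨u, rfl⟩ : ∃ u, x = u * p := ⟨x / p, by field_simp⟩
  have hu : 0 ≤ u := nonneg_of_mul_nonneg_left hx hp
  have hmax : max (u * p - p) 0 = p * max (u - 1) 0 := by
    rw [mul_max_of_nonneg _ _ hp.le]
    ring_nf
  have hpow : u ^ ((3 : ℝ) / 2) = √u ^ 3 := by
    rw [Real.sqrt_eq_rpow, ← Real.rpow_natCast, ← Real.rpow_mul hu]
    norm_num
  have key : u ^ ((3 : ℝ) / 2) ≤ 7 + max (u - 1) 0 ^ 2 / 2 := by
    rw [hpow]
    have hs := Real.sq_sqrt hu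
    have hs0 := Real.sqrt_nonneg u
    have hcube : √u ^ 3 ≤ u * (u + 4) / 4 := by
      have : √u ^ 3 = u * √u := by rw [pow_succ, hs]
      nlinarith [mul_nonneg hu (sq_nonneg (√u - 2))]
    rcases le_total (u - 1) 0 with h | h
    · rw [max_eq_right h]
      nlinarith
    · rw [max_eq_left h]
      nlinarith [sq_nonneg (u - 4)]
  rw [hmax, Real.mul_rpow hu hp.le, Real.rpow_two]
  calc _ ≤ (7 + max (u - 1) 0 ^ 2 / 2) * p ^ ((3 : ℝ) / 2) := by gcongr
    _ = _ := by field_simp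

/-- moment lemma.  If a nonnegative random variable `X` satisfies
`P(X > p + s) ≤ 2·exp(-s²/(6.6·p))` for every `s > 0`, where `p ≥ 1`, then
`E[X^{3/2}] ≤ 14·p^{3/2}`. -/
theorem stmt17 {Ω : Type*} [MeasurableSpace Ω] (μ : Measure Ω) [IsProbabilityMeasure μ]
    (X : Ω → ℝ) (hXmeas : Measurable X) (hXnonneg : ∀ ω, 0 ≤ X ω)
    (p : ℝ) (hp : 1 ≤ p)
    (hTail : ∀ s : ℝ, 0 < s →
      (μ {ω | p + s < X ω}).toReal ≤ 2 * Real.exp (-s ^ 2 / (6.6 * p))) :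
    (∫⁻ ω, ENNReal.ofReal (X ω ^ ((3 : ℝ) / 2)) ∂μ)
      ≤ ENNReal.ofReal (14 * p ^ ((3 : ℝ) / 2)) := by
  have hp0 : 0 < p := by linarith
  set q := p ^ ((3 : ℝ) / 2)
  have hq0 : 0 < q := Real.rpow_pos_of_pos hp0 _
  calc ∫⁻ ω, ENNReal.ofReal (X ω ^ ((3 : ℝ) / 2)) ∂μ
      ≤ ∫⁻ ω, (ENNReal.ofReal (7 * q) + ENNReal.ofReal (q / (2 * p ^ 2)) *
          ENNReal.ofReal (max (X ω - p) 0 ^ (2 : ℝ))) ∂μ := by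
        refine lintegral_mono fun ω => ?_
        rw [← ENNReal.ofReal_mul (by positivity), ← ENNReal.ofReal_add (by positivity)
          (by positivity)]
        exact ENNReal.ofReal_le_ofReal (rpow_three_halves_le (hXnonneg ω) hp0)
    _ = ENNReal.ofReal (7 * q) + ENNReal.ofReal (q / (2 * p ^ 2)) *
          ∫⁻ ω, ENNReal.ofReal (max (X ω - p) 0 ^ (2 : ℝ)) ∂μ := by
        rw [lintegral_add_left measurable_const, lintegral_const, measure_univ, mul_one,
          lintegral_const_mul' _ _ ENNReal.ofReal_ne_top]
    _ ≤ ENNReal.ofReal (7 * q) + ENNReal.ofReal (q / (2 * p ^ 2)) *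
          ENNReal.ofReal (13.2 * p) := by
        gcongr
        exact lintegral_sq_excess_le μ hXmeas hp0 hTail
    _ = ENNReal.ofReal (7 * q + q * (6.6 / p)) := by
        rw [← ENNReal.ofReal_mul (by positivity), ← ENNReal.ofReal_add (by positivity)
          (by positivity)]
        congr 1
        field_simp
        ring
    _ ≤ ENNReal.ofReal (14 * q) := by
        refine ENNReal.ofReal_le_ofReal ?_
        have : 6.6 / p ≤ 7 := by
          rw [div_le_iff₀ hp0]
          linarith
        nlinarith
end
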